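/- Let s ≥ −1 and γ ≥ s + 2 with γ > 1, and let 0 < a ≤ b. There exists a constant C > 0 such that for every r ∈ [a,b] and every ρ > 0 one has |φ₁(ρ|r)| ≤ C H(ρ|r) and |φ₂(ρ|r)| ≤ C H(ρ|r). -/

import Mathlib

noncomputable section

/-- Enthalpy `H(ρ) = ρ^γ/(γ-1)` for the pressure `p(ρ) = ρ^γ`. -/
def enthalpy (γ ρ : ℝ) : ℝ := ρ ^ γ / (γ - 1)

/-- Modulated enthalpy `H(ρ|r) = H(ρ) - H(r) - H'(r)(ρ - r)`,
where `H'(r) = γ r^(γ-1)/(γ-1)`. -/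
def enthalpyMod (γ ρ r : ℝ) : ℝ :=
  enthalpy γ ρ - enthalpy γ r - (γ * r ^ (γ - 1) / (γ - 1)) * (ρ - r)

/-- `μ(ρ) = ρ^((s+3)/2)`. -/
def muF (s ρ : ℝ) : ℝ := ρ ^ ((s + 3) / 2)

/-- `φ(τ) = τ^(2γ/(s+3))`. -/
def phiF (γ s τ : ℝ) : ℝ := τ ^ (2 * γ / (s + 3))

/-- `φ'(τ)` for `φ(τ) = τ^(2γ/(s+3))`. -/
def phiD (γ s τ : ℝ) : ℝ := (2 * γ / (s + 3)) * τ ^ (2 * γ / (s + 3) - 1)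

/-- `φ''(τ)` for `φ(τ) = τ^(2γ/(s+3))`. -/
def phiDD (γ s τ : ℝ) : ℝ :=
  (2 * γ / (s + 3)) * (2 * γ / (s + 3) - 1) * τ ^ (2 * γ / (s + 3) - 2)

/-- `φ₁(ρ|r) = φ(μ(ρ)) − φ(μ(r)) − φ'(μ(r))(μ(ρ) − μ(r))`. -/
def phi1 (γ s ρ r : ℝ) : ℝ :=
  phiF γ s (muF s ρ) - phiF γ s (muF s r) - phiD γ s (muF s r) * (muF s ρ - muF s r)

/-- `φ₂(ρ|r) = φ''(μ(r))(μ(ρ) − μ(r)) r − ρ(φ'(μ(ρ)) − φ'(μ(r)))`. -/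
def phi2 (γ s ρ r : ℝ) : ℝ :=
  phiDD γ s (muF s r) * (muF s ρ - muF s r) * r
    - ρ * (phiD γ s (muF s ρ) - phiD γ s (muF s r))

/-- First-order Taylor remainder of `x ↦ x ^ p` at `1`. -/
def powerGap (p x : ℝ) : ℝ := x ^ p - 1 - p * (x - 1)

theorem powerGap_nonneg {p x : ℝ} (hp : 1 ≤ p) (hx : 0 ≤ x) : 0 ≤ powerGap p x := by
  have h := one_add_mul_self_le_rpow_one_add (s := x - 1) (by linarith) hp
  rw [add_sub_cancel] at h
  unfold powerGap
  linarith

/-- `powerGap` is convex in the exponent and vanishes at exponent `1`. -/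
theorem powerGap_le_powerGap {p q x : ℝ} (hp : 1 ≤ p) (hpq : p ≤ q) (hx : 0 < x) :
    powerGap p x ≤ powerGap q x := by
  rcases hp.eq_or_lt with rfl | hp'
  · simpa [powerGap] using powerGap_nonneg hpq hx.le
  have hq : 0 < q - 1 := by linarith
  obtain ⟨t, ht⟩ : ∃ t, t = (p - 1) / (q - 1) := ⟨_, rfl⟩
  have ht0 : 0 ≤ t := ht ▸ div_nonneg (by linarith) hq.le
  have ht1 : t ≤ 1 := ht ▸ (div_le_one hq).2 (by linarith)
  have htp : p = 1 * (1 - t) + q * t := by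
    rw [ht]
    field_simp
    ring
  have hconv := Real.geom_mean_le_arith_mean2_weighted (sub_nonneg.2 ht1) ht0
    (Real.rpow_nonneg hx.le 1) (Real.rpow_nonneg hx.le q) (sub_add_cancel 1 t)
  rw [← Real.rpow_mul hx.le, ← Real.rpow_mul hx.le, ← Real.rpow_add hx, ← htp,
    Real.rpow_one] at hconv
  have hle : powerGap p x ≤ t * powerGap q x := by
    unfold powerGap
    linear_combination hconv - (x - 1) * htp
  exact hle.trans (mul_le_of_le_one_left (powerGap_nonneg (hp.trans hpq) hx.le) ht1)

theorem enthalpyMod_mul_left {r x : ℝ} (γ : ℝ) (hr : 0 < r) (hx : 0 < x) :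
    enthalpyMod γ (r * x) r = r ^ γ / (γ - 1) * powerGap γ x := by
  have h : r ^ γ = r ^ (γ - 1) * r := by
    rw [← Real.rpow_add_one hr.ne', sub_add_cancel]
  unfold enthalpyMod enthalpy powerGap
  rw [Real.mul_rpow hr.le hx.le]
  linear_combination (γ / (γ - 1) * (x - 1)) * h

theorem rpow_muF {s ρ : ℝ} (e : ℝ) (hρ : 0 < ρ) : muF s ρ ^ e = ρ ^ ((s + 3) / 2 * e) := by
  rw [muF, ← Real.rpow_mul hρ.le]

theorem phi1_mul_left {γ s r x : ℝ} (hs : s + 3 ≠ 0) (hr : 0 < r) (hx : 0 < x) :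
    phi1 γ s (r * x) r =
      r ^ γ * (powerGap γ x - 2 * γ / (s + 3) * powerGap ((s + 3) / 2) x) := by
  have hγ : (s + 3) / 2 * (2 * γ / (s + 3)) = γ := by field_simp
  have hγ' : (s + 3) / 2 * (2 * γ / (s + 3) - 1) = γ - (s + 3) / 2 := by field_simp
  have h : r ^ γ = r ^ (γ - (s + 3) / 2) * r ^ ((s + 3) / 2) := by
    rw [← Real.rpow_add hr, sub_add_cancel]
  unfold phi1 phiF phiD powerGap
  rw [rpow_muF _ hr, rpow_muF _ hr, rpow_muF _ (mul_pos hr hx), hγ, hγ', muF, muF,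
    Real.mul_rpow hr.le hx.le, Real.mul_rpow hr.le hx.le]
  linear_combination (2 * γ / (s + 3) * (x ^ ((s + 3) / 2) - 1)) * h - r ^ γ * (x - 1) * hγ

theorem phi2_mul_left {γ s r x : ℝ} (hs : s + 3 ≠ 0) (hr : 0 < r) (hx : 0 < x) :
    phi2 γ s (r * x) r = r ^ (γ - (s + 3) / 2 + 1) *
      (2 * γ / (s + 3) * (2 * γ / (s + 3) - 1) * powerGap ((s + 3) / 2) x
        - 2 * γ / (s + 3) * powerGap (γ - (s + 3) / 2 + 1) x) := by
  have hγ' : (s + 3) / 2 * (2 * γ / (s + 3) - 1) = γ - (s + 3) / 2 := by field_simp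
  have hγ'' : (s + 3) / 2 * (2 * γ / (s + 3) - 2) = γ - (s + 3) / 2 - (s + 3) / 2 := by
    field_simp
    ring
  have h : r ^ (γ - (s + 3) / 2) =
      r ^ (γ - (s + 3) / 2 - (s + 3) / 2) * r ^ ((s + 3) / 2) := by
    rw [← Real.rpow_add hr, sub_add_cancel]
  unfold phi2 phiD phiDD powerGap
  rw [rpow_muF _ hr, rpow_muF _ hr, rpow_muF _ (mul_pos hr hx), hγ', hγ'', muF, muF,
    Real.mul_rpow hr.le hx.le, Real.mul_rpow hr.le hx.le, Real.rpow_add_one hr.ne',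
    Real.rpow_add_one hx.ne']
  linear_combination
    (-(2 * γ / (s + 3) * (2 * γ / (s + 3) - 1) * (x ^ ((s + 3) / 2) - 1) * r)) * h
      + r ^ (γ - (s + 3) / 2) * r * (2 * γ / (s + 3)) * (x - 1) * hγ'

/-- `|φ₁(ρ|r)|` and `|φ₂(ρ|r)|` are controlled by the modulated enthalpy `H(ρ|r)`,
uniformly for `r` in a compact set `[a,b] ⊆ (0,∞)`. -/
theorem phi1_phi2_le_enthalpyMod (γ s a b : ℝ) (hs : -1 ≤ s) (hγs : s + 2 ≤ γ) (hγ : 1 < γ)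
    (ha : 0 < a) (hab : a ≤ b) :
    ∃ C > 0, ∀ r ∈ Set.Icc a b, ∀ ρ : ℝ, 0 < ρ →
      |phi1 γ s ρ r| ≤ C * enthalpyMod γ ρ r ∧ |phi2 γ s ρ r| ≤ C * enthalpyMod γ ρ r := by
  obtain ⟨k, hk⟩ : ∃ k, k = (s + 3) / 2 := ⟨_, rfl⟩
  obtain ⟨β, hβ⟩ : ∃ β, β = 2 * γ / (s + 3) := ⟨_, rfl⟩
  have hs3 : 0 < s + 3 := by linarith
  have hk1 : 1 ≤ k := by linarith
  have hkγ : k ≤ γ := by linarith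
  have hβ1 : 1 ≤ β := hβ ▸ (one_le_div hs3).2 (by linarith)
  have hγ1 : 0 < γ - 1 := by linarith
  refine ⟨(γ - 1) * (1 + β + β ^ 2 * a ^ (1 - k)), by positivity, ?_⟩
  rintro r ⟨har, -⟩ ρ hρ
  have hr : 0 < r := ha.trans_le har
  obtain ⟨x, hx, rfl⟩ : ∃ x, 0 < x ∧ ρ = r * x :=
    ⟨ρ / r, div_pos hρ hr, (mul_div_cancel₀ ρ hr.ne').symm⟩
  rw [phi1_mul_left hs3.ne' hr hx, phi2_mul_left hs3.ne' hr hx, enthalpyMod_mul_left γ hr hx,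
    ← hk, ← hβ, abs_mul, abs_mul, abs_of_pos (Real.rpow_pos_of_pos hr _),
    abs_of_pos (Real.rpow_pos_of_pos hr _)]
  have hC : (γ - 1) * (1 + β + β ^ 2 * a ^ (1 - k)) * (r ^ γ / (γ - 1) * powerGap γ x) =
      r ^ γ * ((1 + β) * powerGap γ x) + r ^ γ * a ^ (1 - k) * (β ^ 2 * powerGap γ x) := by
    field_simp
  rw [hC]
  have hG : 0 ≤ powerGap γ x := powerGap_nonneg hγ.le hx.le
  have hK : 0 ≤ powerGap k x := powerGap_nonneg hk1 hx.le
  have hKG : powerGap k x ≤ powerGap γ x := powerGap_le_powerGap hk1 hkγ hx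
  have hM : 0 ≤ powerGap (γ - k + 1) x := powerGap_nonneg (by linarith) hx.le
  have hMG : powerGap (γ - k + 1) x ≤ powerGap γ x :=
    powerGap_le_powerGap (by linarith) (by linarith) hx
  have hβK := mul_le_mul_of_nonneg_left hKG (by positivity : 0 ≤ β)
  have hβM := mul_le_mul_of_nonneg_left hMG (by positivity : 0 ≤ β)
  have hββ : 0 ≤ β * (β - 1) := mul_nonneg (by linarith) (by linarith)
  have hββK := mul_le_mul_of_nonneg_left hKG hββ
  have hββK0 := mul_nonneg hββ hK
  have hβK0 : 0 ≤ β * powerGap k x := by positivity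
  have hβM0 : 0 ≤ β * powerGap (γ - k + 1) x := by positivity
  constructor
  · refine le_add_of_le_of_nonneg ?_ (by positivity)
    gcongr
    rw [abs_le]
    constructor <;> linarith
  · refine le_add_of_nonneg_of_le (by positivity) ?_
    have hrpow : r ^ (γ - k + 1) ≤ r ^ γ * a ^ (1 - k) := by
      rw [sub_add, sub_eq_add_neg, Real.rpow_add hr, neg_sub]
      gcongr ?_ * ?_
      exact Real.rpow_le_rpow_of_nonpos ha har (by linarith)
    gcongr
    rw [abs_le]
    constructor <;> nlinarith
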